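/- arXiv:math/0511357 — 4 statements merged into one kernel-verified Lean document; each statement's English description precedes it below -/
import Mathlib

section
/- Let 𝒜 be a semi-abelian category. Consider a commutative diagram whose two rows are short exact sequences, 0→K'→X'→Y'→0 (with kernel k': K'→X' and regular epimorphism f': X'→Y') and 0→K→X→Y→0 (with kernel k: K→X and regular epimorphism f: X→Y), together with vertical morphisms u: K'→K, v: X'→X, w: Y'→Y satisfying v∘k' = k∘u and w∘f' = f∘v. Then w is a monomorphism if and only if the left-hand square (i.e., the commutative square v∘k' = k∘u) is a pullback. -/
open CategoryTheory CategoryTheory.Limits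

universe v u

section Defs

variable {C : Type u} [Category.{v} C]

/-- A finitely complete category is protomodular if, for every commutative diagram of two
adjacent commutative squares in which the middle vertical morphism is a split epimorphism,
whenever the left-hand square and the outer rectangle are pullbacks, so is the right-hand
square. -/
def Protomodular (C : Type u) [Category.{v} C] : Prop :=
  ∀ ⦃A B D A' B' D' : C⦄ (f : A ⟶ B) (g : B ⟶ D)
    (f' : A' ⟶ B') (g' : B' ⟶ D')
    (a : A ⟶ A') (b : B ⟶ B') (d : D ⟶ D'),
    g ≫ d = b ≫ g' →
    IsSplitEpi b →
    IsPullback f a b f' →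
    IsPullback (f ≫ g) a d (f' ≫ g') →
    IsPullback g b d g'

variable [HasZeroMorphisms C] [HasFiniteLimits C]

/-- Two coterminal morphisms `k`, `k'` cooperate (commute in the sense of Huq) when there is
a morphism `φ : K ⨯ K' ⟶ X` restricting to `k` and `k'` along `(1,0)` and `(0,1)`. -/
def Cooperate {K K' X : C} (k : K ⟶ X) (k' : K' ⟶ X) : Prop :=
  ∃ φ : K ⨯ K' ⟶ X, prod.lift (𝟙 K) 0 ≫ φ = k ∧ prod.lift 0 (𝟙 K') ≫ φ = k'

/-- A morphism is central in the sense of Huq when it cooperates with the identity. -/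
def HuqCentral {K X : C} (k : K ⟶ X) : Prop :=
  Cooperate k (𝟙 X)

/-- An object is abelian when its identity cooperates with itself. -/
def IsAbelianObj (A : C) : Prop :=
  Cooperate (𝟙 A) (𝟙 A)

/-- `k` is a kernel of `f`. -/
def IsKernelOf {K X Y : C} (k : K ⟶ X) (f : X ⟶ Y) : Prop :=
  ∃ w : k ≫ f = 0, Nonempty (IsLimit (KernelFork.ofι k w))

/-- A central extension is a regular epimorphism whose kernel is Huq-central. -/
def IsCentralExt {X Y : C} (f : X ⟶ Y) : Prop :=
  Nonempty (RegularEpi f) ∧ HuqCentral (kernel.ι f)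

/-- A normal monomorphism: a morphism that is a kernel of some morphism. -/
def IsNormalMonoP {K X : C} (m : K ⟶ X) : Prop :=
  ∃ (Z : C) (g : X ⟶ Z), IsKernelOf m g

/-- `(p₁, p₂) : R ↣ X ⨯ X` is an internal equivalence relation. -/
structure IsEquivRelation {R X : C} (p₁ p₂ : R ⟶ X) : Prop where
  mono : Mono (prod.lift p₁ p₂)
  refl : ∃ d : X ⟶ R, d ≫ p₁ = 𝟙 X ∧ d ≫ p₂ = 𝟙 X
  symm : ∃ s : R ⟶ R, s ≫ p₁ = p₂ ∧ s ≫ p₂ = p₁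
  trans : ∃ t : pullback p₂ p₁ ⟶ R,
    t ≫ p₁ = pullback.fst p₂ p₁ ≫ p₁ ∧ t ≫ p₂ = pullback.snd p₂ p₁ ≫ p₂

end Defs

/-- A semi-abelian category: pointed, Barr-exact (regular with effective equivalence
relations), protomodular and with binary coproducts. -/
class SemiAbelian (C : Type u) [Category.{v} C] [HasZeroMorphisms C] [HasZeroObject C]
    [HasFiniteLimits C] [HasBinaryCoproducts C] : Prop where
  /-- Every kernel pair has a coequalizer. -/
  hasCoeqOfKernelPair : ∀ {X Y : C} (f : X ⟶ Y),
    HasCoequalizer (pullback.fst f f) (pullback.snd f f)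
  /-- Regular epimorphisms are stable under pullback. -/
  regEpiPullbackStable : ∀ {X Y Z : C} (f : X ⟶ Z) (g : Y ⟶ Z),
    Nonempty (RegularEpi g) → Nonempty (RegularEpi (pullback.fst f g))
  /-- Every internal equivalence relation is effective, i.e. a kernel pair. -/
  equivRelationEffective : ∀ {R X : C} (p₁ p₂ : R ⟶ X), IsEquivRelation p₁ p₂ →
    ∃ (Y : C) (f : X ⟶ Y), IsKernelPair f p₁ p₂
  /-- The category is protomodular. -/
  protomodular : Protomodular C

open scoped ZeroObject

/-- In a pointed protomodular category, a morphism with trivial kernel is a monomorphism. -/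
theorem Protomodular.mono_of_cancel_zero {C : Type u} [Category.{v} C] [HasZeroMorphisms C]
    [HasZeroObject C] [HasPullbacks C] (hC : Protomodular C) {X Y : C} (f : X ⟶ Y)
    (hf : ∀ ⦃T : C⦄ (t : T ⟶ X), t ≫ f = 0 → t = 0) : Mono f := by
  have hsplit : IsSplitEpi (pullback.fst f f) :=
    ⟨⟨{ section_ := pullback.diagonal f }⟩⟩
  have hker : IsPullback (0 : (0 : C) ⟶ pullback f f) (0 : (0 : C) ⟶ (0 : C))
      (pullback.fst f f) (0 : (0 : C) ⟶ X) := by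
    refine ⟨⟨by simp⟩, ⟨PullbackCone.IsLimit.mk _ (fun _ => 0) (fun s => ?_) (fun s => ?_)
      (fun s m _ _ => (isZero_zero C).eq_of_tgt _ _)⟩⟩
    · have h₁ : s.fst ≫ pullback.fst f f = 0 := by simpa using s.condition
      have h₂ : s.fst ≫ pullback.snd f f = 0 :=
        hf _ (by rw [Category.assoc, ← pullback.condition, reassoc_of% h₁, zero_comp])
      rw [zero_comp]
      apply pullback.hom_ext <;> simp [h₁, h₂]
    · exact (isZero_zero C).eq_of_tgt _ _
  have houter : IsPullback ((0 : (0 : C) ⟶ pullback f f) ≫ pullback.fst f f)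
      (0 : (0 : C) ⟶ (0 : C)) (𝟙 X) ((0 : (0 : C) ⟶ X) ≫ 𝟙 X) := by
    rw [zero_comp, zero_comp]
    have : (0 : (0 : C) ⟶ (0 : C)) = 𝟙 _ := (isZero_zero C).eq_of_tgt _ _
    rw [this]
    exact IsPullback.of_vert_isIso ⟨by simp⟩
  have hiso : IsIso (pullback.fst f f) :=
    (hC _ (pullback.fst f f) _ (𝟙 X) _ (pullback.fst f f) (𝟙 X) rfl hsplit hker
      houter).isIso_fst_of_isIso
  have hfst : pullback.fst f f = pullback.snd f f := by
    have : IsIso (pullback.diagonal f) := by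
      have h : pullback.diagonal f ≫ pullback.fst f f = 𝟙 X := by simp
      rw [← IsIso.eq_comp_inv, Category.id_comp] at h
      rw [h]
      infer_instance
    rw [← cancel_epi (pullback.diagonal f)]
    simp
  refine ⟨fun g h e => ?_⟩
  rw [← pullback.lift_fst g h e, hfst, pullback.lift_snd]

/-- In a semi-abelian category, given a morphism of short exact sequences,
`w` is a monomorphism iff the left-hand square is a pullback. -/
theorem statement1 {C : Type u} [Category.{v} C] [HasZeroMorphisms C] [HasZeroObject C]
    [HasFiniteLimits C] [HasBinaryCoproducts C] [SemiAbelian C]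
    {K' X' Y' K X Y : C}
    (k' : K' ⟶ X') (f' : X' ⟶ Y') (k : K ⟶ X) (f : X ⟶ Y)
    (u : K' ⟶ K) (v : X' ⟶ X) (w : Y' ⟶ Y)
    (hk' : IsKernelOf k' f') (hf' : Nonempty (RegularEpi f'))
    (hk : IsKernelOf k f) (hf : Nonempty (RegularEpi f))
    (hleft : k' ≫ v = u ≫ k) (hright : f' ≫ w = v ≫ f) :
    Mono w ↔ IsPullback k' u v k := by
  obtain ⟨wk', ⟨lk'⟩⟩ := hk'
  obtain ⟨wk, ⟨lk⟩⟩ := hk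
  constructor
  · intro hw
    have : Mono k := mono_of_isLimit_fork lk
    have : Mono k' := mono_of_isLimit_fork lk'
    have hzero (s : PullbackCone v k) : s.fst ≫ f' = 0 := by
      rw [← cancel_mono w, Category.assoc, hright, reassoc_of% s.condition, wk, comp_zero,
        zero_comp]
    have hlift (s : PullbackCone v k) :
        lk'.lift (KernelFork.ofι s.fst (hzero s)) ≫ k' = s.fst :=
      lk'.fac (KernelFork.ofι s.fst (hzero s)) WalkingParallelPair.zero
    refine ⟨⟨hleft⟩, ⟨PullbackCone.IsLimit.mk _
      (fun s => lk'.lift (KernelFork.ofι s.fst (hzero s))) hlift (fun s => ?_)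
      (fun s m h _ => ?_)⟩⟩
    · rw [← cancel_mono k, Category.assoc, ← hleft, ← Category.assoc, hlift, s.condition]
    · rw [← cancel_mono k', h, hlift]
  · intro hpb
    refine Protomodular.mono_of_cancel_zero SemiAbelian.protomodular w fun T t ht => ?_
    obtain ⟨hreg⟩ := SemiAbelian.regEpiPullbackStable t f' hf'
    have : Epi (pullback.fst t f') := hreg.epi
    have hzero : (pullback.snd t f' ≫ v) ≫ f = 0 := by
      rw [Category.assoc, ← hright, ← pullback.condition_assoc, ht, comp_zero]
    have hlift : lk.lift (KernelFork.ofι _ hzero) ≫ k = pullback.snd t f' ≫ v :=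
      lk.fac (KernelFork.ofι _ hzero) WalkingParallelPair.zero
    have hfac := hpb.lift_fst _ _ hlift.symm
    rw [← cancel_epi (pullback.fst t f'), pullback.condition, ← hfac, Category.assoc, wk',
      comp_zero, comp_zero]
end

section
/- Let 𝒜 be a semi-abelian category. Consider a commutative diagram whose two rows are short exact sequences, 0→K'→X'→Y'→0 (with kernel k': K'→X' and regular epimorphism f': X'→Y') and 0→K→X→Y→0 (with kernel k: K→X and regular epimorphism f: X→Y), together with vertical morphisms u: K'→K, v: X'→X, w: Y'→Y satisfying v∘k' = k∘u and w∘f' = f∘v. If the left-hand square (the commutative square v∘k' = k∘u) is a pushout, then w is an isomorphism. -/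
open CategoryTheory CategoryTheory.Limits

universe v u

section Protomodular

variable {C : Type u} [Category.{v} C] [HasZeroMorphisms C]

/-- A kernel is a pullback along the map from a zero object. -/
theorem IsKernelOf.isPullback {K X Y : C} {k : K ⟶ X} {f : X ⟶ Y}
    (hk : IsKernelOf k f) {O : C} (hO : IsZero O) :
    IsPullback k (0 : K ⟶ O) f (0 : O ⟶ Y) := by
  obtain ⟨w, ⟨hl⟩⟩ := hk
  have hs (s : PullbackCone f (0 : O ⟶ Y)) : s.fst ≫ f = 0 := by rw [s.condition, comp_zero]
  refine ⟨⟨by rw [w, comp_zero]⟩, ⟨PullbackCone.IsLimit.mk _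
    (fun s => (KernelFork.IsLimit.lift' hl s.fst (hs s)).1) ?_ ?_ ?_⟩⟩
  · exact fun s => (KernelFork.IsLimit.lift' hl s.fst (hs s)).2
  · exact fun s => hO.eq_of_tgt _ _
  · intro s m h₁ _
    exact Fork.IsLimit.hom_ext hl (h₁.trans (KernelFork.IsLimit.lift' hl s.fst (hs s)).2.symm)

/-- In a pointed protomodular category, a monomorphism through which both a section of `p`
and the kernel of `p` factor is an isomorphism. -/
theorem Protomodular.isIso_of_factors (hC : Protomodular C) {E R X K O : C} (hO : IsZero O)
    {e : E ⟶ R} [Mono e] {p : R ⟶ X} {i : K ⟶ R}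
    (hi : IsPullback i (0 : K ⟶ O) p (0 : O ⟶ X))
    (s : X ⟶ E) (hs : s ≫ e ≫ p = 𝟙 X) (j : K ⟶ E) (hj : j ≫ e = i) : IsIso e := by
  have hleft : IsPullback j (0 : K ⟶ O) (e ≫ p) (0 : O ⟶ X) := by
    refine ⟨⟨by rw [reassoc_of% hj, hi.w]⟩, ⟨PullbackCone.IsLimit.mk _
      (fun t => hi.lift (t.fst ≫ e) t.snd (by rw [Category.assoc, t.condition])) ?_ ?_ ?_⟩⟩
    · intro t
      rw [← cancel_mono e, Category.assoc, hj, hi.lift_fst]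
    · exact fun t => hO.eq_of_tgt _ _
    · intro t m h₁ _
      refine hi.hom_ext ?_ (hO.eq_of_tgt _ _)
      rw [hi.lift_fst, ← h₁, Category.assoc, hj]
  have h : IsPullback e (e ≫ p) p (𝟙 X) :=
    hC j e (0 : O ⟶ X) (𝟙 X) 0 (e ≫ p) p (by rw [Category.comp_id]) ⟨⟨⟨s, hs⟩⟩⟩ hleft
      (by rw [hj, Category.comp_id]; exact hi)
  exact h.isIso_fst_of_isIso

/-- In a pointed protomodular category, a regular epimorphism is the cokernel of its kernel. -/
theorem IsKernelOf.exists_factor [HasZeroObject C] [HasFiniteLimits C] (hC : Protomodular C)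
    {K X Y Z : C} {k : K ⟶ X} {f : X ⟶ Y} (hk : IsKernelOf k f) (hf : Nonempty (RegularEpi f))
    (g : X ⟶ Z) (hg : k ≫ g = 0) : ∃ s : Y ⟶ Z, f ≫ s = g := by
  obtain ⟨r⟩ := hf
  obtain ⟨Z₀, hO⟩ := HasZeroObject.zero (C := C)
  have hR := IsPullback.of_hasPullback f f
  obtain ⟨i, hi₁, hi₂⟩ := hR.exists_lift k 0 (by rw [hk.1, zero_comp])
  obtain ⟨d, hd₁, hd₂⟩ := hR.exists_lift (𝟙 X) (𝟙 X) rfl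
  have hi : IsPullback i (0 : K ⟶ Z₀) (pullback.snd f f) (0 : Z₀ ⟶ X) := by
    refine IsPullback.of_right ?_ (by rw [hi₂, zero_comp]) hR
    simpa [hi₁] using hk.isPullback hO
  let a := pullback.fst f f ≫ g
  let b := pullback.snd f f ≫ g
  have hd : d ≫ a = d ≫ b := by simp only [a, b, reassoc_of% hd₁, reassoc_of% hd₂]
  have hiab : i ≫ a = i ≫ b := by
    simp only [a, b, reassoc_of% hi₁, reassoc_of% hi₂, hg, zero_comp]
  have : IsIso (equalizer.ι a b) :=
    hC.isIso_of_factors hO hi (equalizer.lift d hd)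
      (by rw [equalizer.lift_ι_assoc, hd₂]) (equalizer.lift i hiab) (equalizer.lift_ι _ _)
  have hab : a = b := eq_of_epi_equalizer
  obtain ⟨l, hl₁, hl₂⟩ := hR.exists_lift r.left r.right r.w
  refine ⟨r.desc' g ?_, (r.desc' g _).2⟩
  rw [← hl₁, ← hl₂, Category.assoc, Category.assoc]
  exact congrArg (l ≫ ·) hab

end Protomodular

/-- In a semi-abelian category, given a morphism of short exact sequences,
if the left-hand square is a pushout then `w` is an isomorphism. -/
theorem statement2 {C : Type u} [Category.{v} C] [HasZeroMorphisms C] [HasZeroObject C]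
    [HasFiniteLimits C] [HasBinaryCoproducts C] [SemiAbelian C]
    {K' X' Y' K X Y : C}
    (k' : K' ⟶ X') (f' : X' ⟶ Y') (k : K ⟶ X) (f : X ⟶ Y)
    (u : K' ⟶ K) (v : X' ⟶ X) (w : Y' ⟶ Y)
    (hk' : IsKernelOf k' f') (hf' : Nonempty (RegularEpi f'))
    (hk : IsKernelOf k f) (hf : Nonempty (RegularEpi f))
    (hleft : k' ≫ v = u ≫ k) (hright : f' ≫ w = v ≫ f)
    (hpo : IsPushout k' u v k) :
    IsIso w := by
  have := hf'.some.epi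
  have := hf.some.epi
  have hz : k' ≫ f' = u ≫ (0 : K ⟶ Y') := by rw [hk'.1, comp_zero]
  have hkh : k ≫ hpo.desc f' 0 hz = 0 := hpo.inr_desc _ _ _
  have hvh : v ≫ hpo.desc f' 0 hz = f' := hpo.inl_desc _ _ _
  obtain ⟨s, hs⟩ := hk.exists_factor SemiAbelian.protomodular hf (hpo.desc f' 0 hz) hkh
  refine ⟨s, ?_, ?_⟩
  · rw [← cancel_epi f', reassoc_of% hright, hs, hvh, Category.comp_id]
  · rw [← cancel_epi f, reassoc_of% hs, Category.comp_id]
    apply hpo.hom_ext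
    · rw [reassoc_of% hvh, hright]
    · rw [reassoc_of% hkh, zero_comp, hk.1]
end

section
/- Let 𝒜 be a pointed, finitely complete, protomodular category, and let (p1,p2): R ↣ X×X be an internal equivalence relation on an object X. Then R is central in the sense of Smith (i.e., R and the largest equivalence relation ∇_X = (π1,π2): X×X on X centralize) if and only if the normalization k_R = p2 ∘ ker(p1): K[p1] → X of R is a central morphism in the sense of Huq. -/
open CategoryTheory CategoryTheory.Limits

universe v u

/-- Two equivalence relations `(p₁,p₂) : R → X` and `(q₁,q₂) : S → X` centralize in the
sense of Smith: there is a double relation `D` with morphisms `h₁ h₂ : D ⟶ S` and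
`v₁ v₂ : D ⟶ R` making four commutative squares, each of which is a pullback. -/
def Centralize {C : Type u} [Category.{v} C] {R S X : C}
    (p₁ p₂ : R ⟶ X) (q₁ q₂ : S ⟶ X) : Prop :=
  ∃ (D : C) (h₁ h₂ : D ⟶ S) (v₁ v₂ : D ⟶ R),
    IsPullback h₁ v₁ q₁ p₁ ∧ IsPullback h₂ v₁ q₁ p₂ ∧
    IsPullback h₁ v₂ q₂ p₁ ∧ IsPullback h₂ v₂ q₂ p₂

attribute [local simp] prod.lift_fst prod.lift_fst_assoc prod.lift_snd prod.lift_snd_assoc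

open scoped ZeroObject in
/-- A kernel is a pullback along the morphism out of the zero object. -/
theorem isPullback_zero_of_kernel {C : Type u} [Category.{v} C] [HasZeroMorphisms C]
    [HasZeroObject C] {K A B : C} (k : K ⟶ A) (f : A ⟶ B) [Mono k] (w : k ≫ f = 0)
    (h : ∀ {T : C} (t : T ⟶ A), t ≫ f = 0 → ∃ l : T ⟶ K, l ≫ k = t) :
    IsPullback k (0 : K ⟶ 0) f (0 : 0 ⟶ B) :=
  .of_isLimit' ⟨by simpa using w⟩ <|
    PullbackCone.IsLimit.mk _
      (fun s => (h s.fst (by simpa using s.condition)).choose)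
      (fun s => (h s.fst (by simpa using s.condition)).choose_spec)
      (fun s => HasZeroObject.to_zero_ext _ _)
      (fun s m hm _ => by
        rw [← cancel_mono k, hm]
        exact (h s.fst (by simpa using s.condition)).choose_spec.symm)

/-- The split short five lemma: a morphism between objects over `B`, the source being split
over `B`, is invertible as soon as it identifies a kernel of the source with one of the
target. -/
theorem Protomodular.isIso_of_kernel {C : Type u} [Category.{v} C] [HasZeroMorphisms C]
    [HasZeroObject C] (hproto : Protomodular C) {K A A' B : C} (k : K ⟶ A) (g : A ⟶ A')
    (f : A' ⟶ B) (s : B ⟶ A) (hs : s ≫ g ≫ f = 𝟙 B) [Mono (k ≫ g)] (w : k ≫ g ≫ f = 0)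
    (h : ∀ {T : C} (t : T ⟶ A), t ≫ g ≫ f = 0 → ∃ l : T ⟶ K, l ≫ k = t)
    (h' : ∀ {T : C} (t : T ⟶ A'), t ≫ f = 0 → ∃ l : T ⟶ K, l ≫ k ≫ g = t) :
    IsIso g := by
  have : Mono k := mono_of_mono k g
  have right := hproto k g 0 (𝟙 B) 0 (g ≫ f) f (by simp) ⟨⟨⟨s, hs⟩⟩⟩
    (isPullback_zero_of_kernel k (g ≫ f) w h)
    (by simpa using isPullback_zero_of_kernel (k ≫ g) f (by simpa using w) h')
  exact right.isIso_fst_of_isIso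

/-- A monomorphism into `A` through which a kernel and a section of `f : A ⟶ B` both factor is
invertible. -/
theorem Protomodular.isIso_of_mono {C : Type u} [Category.{v} C] [HasZeroMorphisms C]
    [HasZeroObject C] (hproto : Protomodular C) {K M A B : C} (k : K ⟶ M) (m : M ⟶ A) [Mono m]
    (f : A ⟶ B) (s : B ⟶ M) (hs : s ≫ m ≫ f = 𝟙 B) [Mono (k ≫ m)] (w : k ≫ m ≫ f = 0)
    (h : ∀ {T : C} (t : T ⟶ A), t ≫ f = 0 → ∃ l : T ⟶ K, l ≫ k ≫ m = t) :
    IsIso m := by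
  refine hproto.isIso_of_kernel k m f s hs w (fun t ht => ?_) h
  obtain ⟨l, hl⟩ := h (t ≫ m) (by simpa using ht)
  exact ⟨l, by simpa [← cancel_mono m] using hl⟩

section

variable {C : Type u} [Category.{v} C] [HasFiniteLimits C] {K X : C}

/-- The action `ψ` applied to both entries of a pair is a pullback of `ψ` along the first
projection, provided `(k, x) ↦ (k, ψ (k, x))` is invertible. -/
theorem isPullback_prod_fst (ψ : K ⨯ X ⟶ X) [IsIso (prod.lift prod.fst ψ)] :
    IsPullback
      (prod.lift (prod.map (𝟙 K) prod.fst ≫ ψ) (prod.map (𝟙 K) prod.snd ≫ ψ) :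
        K ⨯ (X ⨯ X) ⟶ X ⨯ X)
      (prod.map (𝟙 K) prod.fst) prod.fst ψ := by
  have hfst : inv (prod.lift prod.fst ψ) ≫ prod.fst = prod.fst := by simp
  have hψ : inv (prod.lift prod.fst ψ) ≫ ψ = prod.snd := by simp
  generalize hβ : inv (prod.lift prod.fst ψ) = β at hfst hψ
  refine .of_isLimit' ⟨by simp⟩ <| PullbackCone.IsLimit.mk _
    (fun s => prod.lift (s.snd ≫ prod.fst) (prod.lift (s.snd ≫ prod.snd)
      (prod.lift (s.snd ≫ prod.fst) (s.fst ≫ prod.snd) ≫ β ≫ prod.snd))) ?_ ?_ ?_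
  · intro s
    have key : prod.lift (s.snd ≫ prod.fst)
        (prod.lift (s.snd ≫ prod.fst) (s.fst ≫ prod.snd) ≫ β ≫ prod.snd) =
        prod.lift (s.snd ≫ prod.fst) (s.fst ≫ prod.snd) ≫ β := by
      ext <;> simp [hfst]
    have hs : prod.lift (s.snd ≫ prod.fst) (s.snd ≫ prod.snd) = s.snd := by ext <;> simp
    ext
    · simp [← Category.assoc, prod.lift_map, hs, s.condition]
    · simp only [prod.comp_lift, prod.lift_snd, prod.lift_map_assoc, Category.comp_id, key,
        Category.assoc, hψ]
  · intro s
    ext <;> simp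
  · intro s m h₁ h₂
    have hk : m ≫ prod.fst = s.snd ≫ prod.fst := by simp [← h₂]
    have hx : m ≫ prod.snd ≫ prod.fst = s.snd ≫ prod.snd := by simp [← h₂]
    have hy : m ≫ prod.map (𝟙 K) prod.snd =
        prod.lift (s.snd ≫ prod.fst) (s.fst ≫ prod.snd) ≫ β := by
      rw [← hβ, IsIso.eq_comp_inv]
      ext <;> simp [← h₁, ← h₂]
    ext
    · simp [hk]
    · simp [hx]
    · simpa using congr($hy ≫ prod.snd)

/-- The action `ψ` applied to both entries of a pair is a pullback of `ψ` along the second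
projection, provided `(k, x) ↦ (k, ψ (k, x))` is invertible. -/
theorem isPullback_prod_snd (ψ : K ⨯ X ⟶ X) [IsIso (prod.lift prod.fst ψ)] :
    IsPullback
      (prod.lift (prod.map (𝟙 K) prod.fst ≫ ψ) (prod.map (𝟙 K) prod.snd ≫ ψ) :
        K ⨯ (X ⨯ X) ⟶ X ⨯ X)
      (prod.map (𝟙 K) prod.snd) prod.snd ψ := by
  refine (isPullback_prod_fst ψ).of_iso (prod.mapIso (Iso.refl K) (prod.braiding X X))
    (prod.braiding X X) (Iso.refl _) (Iso.refl _) ?_ ?_ ?_ ?_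
  · ext <;> simp [← Category.assoc]
  · ext <;> simp
  · simp
  · simp

end

section

variable {C : Type u} [Category.{v} C] [HasZeroMorphisms C] [HasFiniteLimits C]

/-- A relation centralizing with the largest one has a Huq-central normalization. -/
theorem Centralize.huqCentral {R X : C} {p₁ p₂ : R ⟶ X}
    (h : Centralize p₁ p₂ (prod.fst : X ⨯ X ⟶ X) (prod.snd : X ⨯ X ⟶ X)) :
    HuqCentral (kernel.ι p₁ ≫ p₂) := by
  obtain ⟨D, h₁, h₂, v₁, v₂, h11, h21, h12, h22⟩ := h
  let a : kernel p₁ ⟶ D := h12.lift 0 (kernel.ι p₁) (by simp)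
  have ha₁ : a ≫ h₁ = 0 := h12.lift_fst _ _ _
  have ha₂ : a ≫ v₂ = kernel.ι p₁ := h12.lift_snd _ _ _
  let b : X ⟶ D := h21.lift (prod.lift 0 (𝟙 X)) 0 (by simp)
  have hb₁ : b ≫ h₂ = prod.lift 0 (𝟙 X) := h21.lift_fst _ _ _
  have hb₂ : b ≫ v₁ = 0 := h21.lift_snd _ _ _
  have hak : (a ≫ v₁) ≫ p₁ = 0 := by
    rw [Category.assoc, ← h11.w, ← Category.assoc, ha₁, zero_comp]
  have hbx : (b ≫ h₁) ≫ prod.fst = 0 := by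
    rw [Category.assoc, h11.w, ← Category.assoc, hb₂, zero_comp]
  let m : kernel p₁ ⨯ X ⟶ D := h11.lift (prod.snd ≫ b ≫ h₁) (prod.fst ≫ a ≫ v₁) (by
    rw [Category.assoc, Category.assoc prod.fst, hbx, hak, comp_zero, comp_zero])
  have hm₁ : m ≫ h₁ = prod.snd ≫ b ≫ h₁ := h11.lift_fst _ _ _
  have hm₂ : m ≫ v₁ = prod.fst ≫ a ≫ v₁ := h11.lift_snd _ _ _
  have hma : prod.lift (𝟙 _) 0 ≫ m = a :=
    h11.hom_ext (by simp [hm₁, ha₁]) (by simp [hm₂])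
  have hmb : prod.lift 0 (𝟙 _) ≫ m = b :=
    h11.hom_ext (by simp [hm₁]) (by simp [hm₂, hb₂])
  refine ⟨m ≫ h₂ ≫ prod.snd, ?_, ?_⟩
  · rw [← Category.assoc, hma, h22.w, ← Category.assoc, ha₂]
  · rw [← Category.assoc, hmb, ← Category.assoc, hb₁, prod.lift_snd]

variable [HasZeroObject C]

/-- In the protomodular setting a cooperator `φ` of `k` with the identity makes
`(k, x) ↦ (k, φ (k, x))` invertible. -/
theorem Protomodular.isIso_lift_fst (hproto : Protomodular C) {K X : C} (φ : K ⨯ X ⟶ X)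
    (hφ : prod.lift 0 (𝟙 X) ≫ φ = 𝟙 X) : IsIso (prod.lift prod.fst φ) := by
  have e : prod.lift 0 (𝟙 X) ≫ prod.lift prod.fst φ = prod.lift (0 : X ⟶ K) (𝟙 X) := by
    ext <;> simp [hφ]
  have : Mono (prod.lift (0 : X ⟶ K) (𝟙 X)) :=
    mono_of_mono_fac (prod.lift_snd (0 : X ⟶ K) (𝟙 X))
  have : Mono (prod.lift (0 : X ⟶ K) (𝟙 X) ≫ prod.lift prod.fst φ) := by rwa [e]
  refine hproto.isIso_of_kernel (prod.lift (0 : X ⟶ K) (𝟙 X)) _ prod.fst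
    (prod.lift (𝟙 K) 0) (by simp) (by simp) (fun t ht => ⟨t ≫ prod.snd, ?_⟩)
    (fun t ht => ⟨t ≫ prod.snd, ?_⟩)
  · rw [prod.lift_fst] at ht
    ext <;> simp [ht]
  · rw [e]
    ext <;> simp [ht]

/-- If the normalization of a reflexive relation `R` cooperates with the identity through `φ`,
then `(k, x) ↦ (x, φ (k, x))` identifies `K ⨯ X` with `R`. -/
theorem Protomodular.exists_isIso_of_cooperator (hproto : Protomodular C) {R X : C}
    {p₁ p₂ : R ⟶ X} [Mono (prod.lift p₁ p₂)] {d : X ⟶ R} (hd₁ : d ≫ p₁ = 𝟙 X)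
    (hd₂ : d ≫ p₂ = 𝟙 X) {φ : kernel p₁ ⨯ X ⟶ X}
    (hφ₁ : prod.lift (𝟙 _) 0 ≫ φ = kernel.ι p₁ ≫ p₂) (hφ₂ : prod.lift 0 (𝟙 X) ≫ φ = 𝟙 X) :
    ∃ θ : kernel p₁ ⨯ X ⟶ R, IsIso θ ∧ θ ≫ p₁ = prod.snd ∧ θ ≫ p₂ = φ := by
  have hker {T : C} (t : T ⟶ kernel p₁ ⨯ X) (ht : t ≫ prod.snd = 0) :
      (t ≫ prod.fst) ≫ prod.lift (𝟙 _) 0 = t := by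
    ext <;> simp [ht]
  have : Mono (prod.lift (𝟙 (kernel p₁)) (0 : kernel p₁ ⟶ X)) :=
    mono_of_mono_fac (prod.lift_fst _ _)
  -- The relation contains every pair `(x, φ (k, x))`.
  let q : kernel p₁ ⨯ X ⟶ X ⨯ X := prod.lift prod.snd φ
  let k : kernel p₁ ⟶ pullback q (prod.lift p₁ p₂) :=
    pullback.lift (prod.lift (𝟙 _) 0) (kernel.ι p₁) (by ext <;> simp [q, hφ₁])
  let s : X ⟶ pullback q (prod.lift p₁ p₂) :=
    pullback.lift (prod.lift 0 (𝟙 X)) d (by ext <;> simp [q, hφ₂, hd₁, hd₂])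
  have hk : k ≫ pullback.fst _ _ = prod.lift (𝟙 _) 0 := pullback.lift_fst _ _ _
  have hs : s ≫ pullback.fst _ _ = prod.lift 0 (𝟙 X) := pullback.lift_fst _ _ _
  have : Mono (k ≫ pullback.fst q (prod.lift p₁ p₂)) := by rwa [hk]
  have : IsIso (pullback.fst q (prod.lift p₁ p₂)) :=
    hproto.isIso_of_mono k _ prod.snd s (by simp [reassoc_of% hs]) (by simp [reassoc_of% hk])
      fun t ht => ⟨_, by rw [hk]; exact hker t ht⟩
  let θ := inv (pullback.fst q (prod.lift p₁ p₂)) ≫ pullback.snd _ _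
  have hθ : θ ≫ prod.lift p₁ p₂ = q := by
    rw [Category.assoc, ← pullback.condition, IsIso.inv_hom_id_assoc]
  have hθ₁ : θ ≫ p₁ = prod.snd := by simpa [q] using congr($hθ ≫ prod.fst)
  have hθ₂ : θ ≫ p₂ = φ := by simpa [q] using congr($hθ ≫ prod.snd)
  have hι : prod.lift (𝟙 _) 0 ≫ θ = kernel.ι p₁ := by
    rw [← cancel_mono (prod.lift p₁ p₂)]
    ext <;> simp [hθ₁, hθ₂, hφ₁]
  have : Mono (prod.lift (𝟙 _) 0 ≫ θ) := by rw [hι]; infer_instance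
  refine ⟨θ, ?_, hθ₁, hθ₂⟩
  refine hproto.isIso_of_kernel (prod.lift (𝟙 _) 0) θ p₁ (prod.lift 0 (𝟙 X)) (by simp [hθ₁])
    (by simp [hθ₁]) (fun t ht => ⟨_, hker t (by rwa [hθ₁] at ht)⟩)
    (fun t ht => ⟨kernel.lift p₁ t ht, ?_⟩)
  rw [hι, kernel.lift_ι]

/-- A reflexive relation with Huq-central normalization centralizes with the largest one. -/
theorem Protomodular.centralize_of_huqCentral (hproto : Protomodular C) {R X : C}
    {p₁ p₂ : R ⟶ X} [Mono (prod.lift p₁ p₂)] {d : X ⟶ R} (hd₁ : d ≫ p₁ = 𝟙 X)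
    (hd₂ : d ≫ p₂ = 𝟙 X) (h : HuqCentral (kernel.ι p₁ ≫ p₂)) :
    Centralize p₁ p₂ (prod.fst : X ⨯ X ⟶ X) (prod.snd : X ⨯ X ⟶ X) := by
  obtain ⟨φ, hφ₁, hφ₂⟩ := h
  obtain ⟨θ, _, hθ₁, hθ₂⟩ := hproto.exists_isIso_of_cooperator hd₁ hd₂ hφ₁ hφ₂
  have := hproto.isIso_lift_fst φ hφ₂
  have : IsIso (prod.lift prod.fst prod.snd : kernel p₁ ⨯ X ⟶ _) := by
    rw [prod.lift_fst_snd]; infer_instance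
  have transport {D Y : C} {l : D ⟶ Y} {w : D ⟶ kernel p₁ ⨯ X} {q : Y ⟶ X} {ψ} {p : R ⟶ X}
      (hp : θ ≫ p = ψ) (sq : IsPullback l w q ψ) : IsPullback l (w ≫ θ) q p :=
    sq.of_iso (Iso.refl _) (Iso.refl _) (asIso θ) (Iso.refl _) (by simp) (by simp) (by simp)
      (by simp [hp])
  exact ⟨_, _, _, _, _, transport hθ₁ (isPullback_prod_fst prod.snd),
    transport hθ₂ (isPullback_prod_fst φ), transport hθ₁ (isPullback_prod_snd prod.snd),
    transport hθ₂ (isPullback_prod_snd φ)⟩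

end

/-- In a pointed, finitely complete, protomodular category, an internal equivalence
relation `R` on `X` is Smith-central (it centralizes with `∇_X`) if and only if its
normalization `k_R = p₂ ∘ ker p₁` is Huq-central. -/
theorem statement4 {C : Type u} [Category.{v} C] [HasZeroMorphisms C] [HasZeroObject C]
    [HasFiniteLimits C] (hproto : Protomodular C)
    {R X : C} (p₁ p₂ : R ⟶ X) (hR : IsEquivRelation p₁ p₂) :
    Centralize p₁ p₂ (prod.fst : X ⨯ X ⟶ X) (prod.snd : X ⨯ X ⟶ X) ↔
      HuqCentral (kernel.ι p₁ ≫ p₂) := by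
  obtain ⟨d, hd₁, hd₂⟩ := hR.refl
  have := hR.mono
  exact ⟨Centralize.huqCentral, hproto.centralize_of_huqCentral hd₁ hd₂⟩
end

section
/- Let 𝒜 be a semi-abelian category. If an object Y of 𝒜 admits a universal central extension (an initial object in the category of central extensions of Y, i.e., a central extension u: U→Y such that for every central extension g: Z→Y there exists exactly one morphism h: U→Z with g∘h = u), then Y is perfect, i.e., every morphism from Y to an abelian object of 𝒜 is the zero morphism. -/
open CategoryTheory CategoryTheory.Limits

universe v u

/-- The second projection `A ⨯ Y ⟶ Y` is a central extension when `A` is abelian. -/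
theorem IsAbelianObj.isCentralExt_snd {C : Type u} [Category.{v} C] [HasZeroMorphisms C]
    [HasFiniteLimits C] {A : C} (hA : IsAbelianObj A) (Y : C) :
    IsCentralExt (prod.snd : A ⨯ Y ⟶ Y) := by
  obtain ⟨m, hm₁, hm₂⟩ := hA
  refine ⟨⟨RegularEpi.ofSplitEpi _⟩, ?_⟩
  have left_unit {X : C} (x : X ⟶ A) : prod.lift 0 x ≫ m = x := by
    have : (prod.lift 0 x : X ⟶ A ⨯ A) = x ≫ prod.lift 0 (𝟙 A) := by ext <;> simp
    rw [this, Category.assoc, hm₂, Category.comp_id]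
  have right_unit {X : C} (x : X ⟶ A) : prod.lift x 0 ≫ m = x := by
    have : (prod.lift x 0 : X ⟶ A ⨯ A) = x ≫ prod.lift (𝟙 A) 0 := by ext <;> simp
    rw [this, Category.assoc, hm₁, Category.comp_id]
  refine ⟨prod.lift (prod.lift (prod.fst ≫ kernel.ι _ ≫ prod.fst) (prod.snd ≫ prod.fst) ≫ m)
    (prod.snd ≫ prod.snd), ?_, ?_⟩
  · ext
    · simp [prod.lift_fst, prod.lift_snd_assoc, right_unit]
    · simp [prod.lift_snd, prod.lift_snd_assoc]
  · ext
    · simp [prod.lift_snd_assoc, left_unit]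
    · simp [prod.lift_snd_assoc, left_unit]

/-- In a semi-abelian category, if `Y` admits a universal central extension then `Y` is
perfect: every morphism from `Y` to an abelian object is zero. -/
theorem statement9 {C : Type u} [Category.{v} C] [HasZeroMorphisms C] [HasZeroObject C]
    [HasFiniteLimits C] [HasBinaryCoproducts C] [SemiAbelian C]
    {U Y : C} (u : U ⟶ Y) (hu : IsCentralExt u)
    (huniv : ∀ (Z : C) (g : Z ⟶ Y), IsCentralExt g → ∃! h : U ⟶ Z, h ≫ g = u) :
    ∀ (A : C) (a : Y ⟶ A), IsAbelianObj A → a = 0 := by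
  intro A a hA
  obtain ⟨_, _, huniq⟩ := huniv _ _ (hA.isCentralExt_snd Y)
  have hlift : prod.lift (u ≫ a) u = prod.lift 0 u :=
    (huniq _ (prod.lift_snd _ _)).trans (huniq _ (prod.lift_snd _ _)).symm
  have hua : u ≫ a = 0 := by
    simpa [prod.lift_fst] using congrArg (· ≫ (prod.fst : A ⨯ Y ⟶ A)) hlift
  obtain ⟨⟨hreg⟩, _⟩ := hu
  have : Epi u := hreg.epi
  exact (cancel_epi u).mp (hua.trans comp_zero.symm)
end
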